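/- Let λ be a strongly compact cardinal. Then for every topological space X such that the tightness t(p, X) at every point p ∈ X is less than λ, the tightness of the Gδ-modification satisfies t(X_δ) ≤ λ. -/

import Mathlib

open Cardinal Set

universe u

/-- The Gδ-modification of a topology: the topology generated by all Gδ sets. -/
def gDeltaModification {X : Type u} (t : TopologicalSpace X) : TopologicalSpace X :=
  TopologicalSpace.generateFrom {s : Set X | @IsGδ X t s}

/-- The tightness of a topological space: the smallest infinite cardinal `κ` such that
whenever a point `p` lies in the closure of a set `A`, there is `B ⊆ A` with `|B| ≤ κ`
and `p` in the closure of `B`. -/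
noncomputable def tightness (X : Type u) [TopologicalSpace X] : Cardinal.{u} :=
  sInf {κ : Cardinal.{u} | ℵ₀ ≤ κ ∧ ∀ (A : Set X) (p : X), p ∈ closure A →
    ∃ B ⊆ A, #B ≤ κ ∧ p ∈ closure B}

/-- The tightness of a space at a point `p`: the smallest infinite cardinal `κ` such
that whenever `p` lies in the closure of a set `A`, there is `B ⊆ A` with `|B| ≤ κ`
and `p` in the closure of `B`. -/
noncomputable def pointTightness {X : Type u} [TopologicalSpace X] (p : X) : Cardinal.{u} :=
  sInf {κ : Cardinal.{u} | ℵ₀ ≤ κ ∧ ∀ A : Set X, p ∈ closure A →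
    ∃ B ⊆ A, #B ≤ κ ∧ p ∈ closure B}

/-- An ultrafilter is `λ`-complete if it is closed under intersections of fewer than
`λ` of its members. -/
def IsLambdaComplete {α : Type u} (U : Ultrafilter α) (l : Cardinal.{u}) : Prop :=
  ∀ s : Set (Set α), #s < l → (∀ v ∈ s, v ∈ U) → ⋂₀ s ∈ U

/-- `λ` is a strongly compact cardinal: `λ` is uncountable and for every set `A` of
cardinality at least `λ` there is a `λ`-complete fine free ultrafilter on `[A]^{<λ}`,
the collection of subsets of `A` of cardinality less than `λ` (`fine` means that for
every `a ∈ A` the set `{B ∈ [A]^{<λ} : a ∈ B}` belongs to the ultrafilter; `free`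
means that the ultrafilter contains no singleton). -/
def IsStronglyCompact (l : Cardinal.{u}) : Prop :=
  Cardinal.aleph0 < l ∧
  ∀ A : Type u, l ≤ #A →
    ∃ U : Ultrafilter {B : Set A // #B < l},
      IsLambdaComplete U l ∧
      (∀ a : A, {B : {B : Set A // #B < l} | a ∈ B.1} ∈ U) ∧
      (∀ B₀ : {B : Set A // #B < l}, ({B₀} : Set {B : Set A // #B < l}) ∉ U)

theorem IsLambdaComplete.iInter_mem {α : Type u} {U : Ultrafilter α} {l : Cardinal.{u}}
    (hU : IsLambdaComplete U l) {ι : Type u} (hι : #ι < l) {S : ι → Set α}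
    (hS : ∀ i, S i ∈ U) : ⋂ i, S i ∈ U := by
  rw [← sInter_range]
  exact hU _ (mk_range_le.trans_lt hι) (by rintro _ ⟨i, rfl⟩; exact hS i)

theorem IsLambdaComplete.exists_mem_of_iUnion_mem {α : Type u} {U : Ultrafilter α}
    {l : Cardinal.{u}} (hU : IsLambdaComplete U l) (hl : ℵ₀ < l) {S : ℕ → Set α}
    (hS : ⋃ n, S n ∈ U) : ∃ n, S n ∈ U := by
  by_contra! h
  have hι : #(ULift.{u} ℕ) < l := by simpa using hl
  have hc : ⋂ i : ULift.{u} ℕ, (S i.down)ᶜ ∈ U :=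
    hU.iInter_mem hι fun i => Ultrafilter.compl_mem_iff_notMem.2 (h i.down)
  obtain ⟨x, hx, hx'⟩ := U.nonempty_of_mem (Filter.inter_mem hS hc)
  obtain ⟨n, hn⟩ := mem_iUnion.1 hx
  exact mem_iInter.1 hx' ⟨n⟩ hn

theorem isTopologicalBasis_gDeltaModification {X : Type u} [t : TopologicalSpace X] :
    @TopologicalSpace.IsTopologicalBasis X (gDeltaModification t) {s | IsGδ s} :=
  @TopologicalSpace.IsTopologicalBasis.mk X (gDeltaModification t) {s | IsGδ s}
    (fun s hs s' hs' _ hx => ⟨s ∩ s', IsGδ.inter hs hs', hx, Subset.rfl⟩)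
    (sUnion_eq_univ_iff.2 fun _ => ⟨univ, IsGδ.univ, mem_univ _⟩)
    rfl

theorem mem_closure_gDeltaModification_iff {X : Type u} [t : TopologicalSpace X]
    {A : Set X} {p : X} :
    p ∈ @closure X (gDeltaModification t) A ↔
      ∀ G : Set X, IsGδ G → p ∈ G → (G ∩ A).Nonempty :=
  @TopologicalSpace.IsTopologicalBasis.mem_closure_iff X (gDeltaModification t) _
    isTopologicalBasis_gDeltaModification _ _

/-- A point outside the `Gδ`-closure of `B` is avoided by countably many closed sets
that cover `B`. -/
theorem exists_isClosed_cover_of_notMem_closure_gDeltaModification {X : Type u}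
    [t : TopologicalSpace X] {B : Set X} {p : X}
    (hp : p ∉ @closure X (gDeltaModification t) B) :
    ∃ F : ℕ → Set X, (∀ n, IsClosed (F n)) ∧ (∀ n, p ∉ F n) ∧ B ⊆ ⋃ n, F n := by
  rw [mem_closure_gDeltaModification_iff] at hp
  push Not at hp
  obtain ⟨G, hG, hpG, hGB⟩ := hp
  obtain ⟨V, hV, rfl⟩ := isGδ_iff_eq_iInter_nat.1 hG
  refine ⟨fun n => (V n)ᶜ, fun n => (hV n).isClosed_compl,
    fun n hn => hn (mem_iInter.1 hpG n), fun x hx => ?_⟩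
  rw [← compl_iInter]
  exact fun hx' => (eq_empty_iff_forall_notMem.1 hGB x) ⟨hx', hx⟩

theorem exists_mem_closure_of_subset_iUnion {X : Type u} [t : TopologicalSpace X]
    {A : Set X} {p : X} (hp : p ∈ @closure X (gDeltaModification t) A)
    {S : ℕ → Set X} (hA : A ⊆ ⋃ n, S n) : ∃ n, p ∈ closure (S n) := by
  by_contra! h
  obtain ⟨x, hx, hxA⟩ := mem_closure_gDeltaModification_iff.1 hp (⋂ n, (closure (S n))ᶜ)
    (.iInter_of_isOpen fun n => isClosed_closure.isOpen_compl) (mem_iInter.2 h)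
  obtain ⟨n, hn⟩ := mem_iUnion.1 (hA hxA)
  exact mem_iInter.1 hx n (subset_closure hn)

theorem exists_subset_mk_le_pointTightness {X : Type u} [TopologicalSpace X] {A : Set X}
    {p : X} (hp : p ∈ closure A) : ∃ B ⊆ A, #B ≤ pointTightness p ∧ p ∈ closure B := by
  have h : pointTightness p ∈ {κ : Cardinal.{u} | ℵ₀ ≤ κ ∧ ∀ A : Set X, p ∈ closure A →
      ∃ B ⊆ A, #B ≤ κ ∧ p ∈ closure B} :=
    csInf_mem ⟨max ℵ₀ #X, le_max_left _ _, fun A hA =>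
      ⟨A, Subset.rfl, (mk_set_le A).trans (le_max_right _ _), hA⟩⟩
  exact h.2 A hp

theorem exists_subset_mk_lt_mem_closure_gDeltaModification
    {l : Cardinal.{u}} (hl : IsStronglyCompact l) {X : Type u} [t : TopologicalSpace X]
    {A : Set X} {p : X} (ht : pointTightness p < l)
    (hp : p ∈ @closure X (gDeltaModification t) A) :
    ∃ B ⊆ A, #B < l ∧ p ∈ @closure X (gDeltaModification t) B := by
  by_contra! h
  have hA : l ≤ #A := not_lt.1 fun hA => h A Subset.rfl hA hp
  obtain ⟨U, hU, hfine, -⟩ := hl.2 A hA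
  have hcover : ∀ B : {B : Set A // #B < l}, ∃ F : ℕ → Set X,
      (∀ n, IsClosed (F n)) ∧ (∀ n, p ∉ F n) ∧ Subtype.val '' B.1 ⊆ ⋃ n, F n := fun B =>
    exists_isClosed_cover_of_notMem_closure_gDeltaModification
      (h _ (Subtype.coe_image_subset A B.1) (mk_image_le.trans_lt B.2))
  choose F hFclosed hpF hF using hcover
  have hAS : A ⊆ ⋃ n, {a | {B | a ∈ F B n} ∈ U} := fun a ha => by
    refine mem_iUnion.2 (hU.exists_mem_of_iUnion_mem hl.1 ?_)
    filter_upwards [hfine ⟨a, ha⟩] with B hB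
    obtain ⟨n, hn⟩ := mem_iUnion.1 (hF B ⟨_, hB, rfl⟩)
    exact mem_iUnion.2 ⟨n, hn⟩
  obtain ⟨n, hn⟩ := exists_mem_closure_of_subset_iUnion hp hAS
  obtain ⟨C, hC, hCl, hpC⟩ := exists_subset_mk_le_pointTightness hn
  have hmem : ⋂ c : C, {B | c.1 ∈ F B n} ∈ U :=
    hU.iInter_mem (hCl.trans_lt ht) fun c => hC c.2
  obtain ⟨B, hB⟩ := U.nonempty_of_mem hmem
  exact hpF B n (closure_minimal (fun c hc => mem_iInter.1 hB ⟨c, hc⟩) (hFclosed B n) hpC)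

/-- If `λ` is a strongly compact cardinal, then for every topological space `X` with
`t(p, X) < λ` at every point `p`, the tightness of the Gδ-modification satisfies
`t(X_δ) ≤ λ`. -/
theorem tightness_gDelta_le_of_stronglyCompact
    (l : Cardinal.{u}) (hl : IsStronglyCompact l)
    (X : Type u) [t : TopologicalSpace X]
    (ht : ∀ p : X, pointTightness p < l) :
    @tightness X (gDeltaModification t) ≤ l := by
  refine csInf_le' ⟨hl.1.le, fun A p hp => ?_⟩
  obtain ⟨B, hBA, hB, hpB⟩ :=
    exists_subset_mk_lt_mem_closure_gDeltaModification hl (ht p) hp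
  exact ⟨B, hBA, hB.le, hpB⟩
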